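/- arXiv:1912.08288 — 2 statements merged into one kernel-verified Lean document; each statement's English description precedes it below -/
import Mathlib

section
/- (Filtration decomposition over a field, the key step in the proof of Theorem 2.6.) Let 𝕜 be a field, C a 𝕜-vector space, and B ⊆ Z ⊆ C subspaces. Let F₋₁ ⊆ F₀ ⊆ F₁ ⊆ ⋯ ⊆ F_m be subspaces of C with F₋₁ = 0 and F_m = C. Then there is a 𝕜-linear isomorphism Z / B ≅ ⨁_{p=0}^{m} (F_p ∩ Z) / ((F_{p−1} ∩ Z) + (F_p ∩ B)), where each summand is the quotient of the subspace F_p ∩ Z by its subspace (F_{p−1} ∩ Z) + (F_p ∩ B). -/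
open Submodule
open scoped DirectSum

theorem filtration_decomposition {𝕜 C : Type*} [Field 𝕜] [AddCommGroup C] [Module 𝕜 C]
    (Z B : Submodule 𝕜 C) (hBZ : B ≤ Z)
    (m : ℕ) (F : ℤ → Submodule 𝕜 C)
    (hFbot : F (-1) = ⊥) (hFtop : F (m : ℤ) = ⊤)
    (hFmono : ∀ p : ℤ, -1 ≤ p → p < (m : ℤ) → F p ≤ F (p + 1)) :
    Nonempty
      ((Z ⧸ (Submodule.comap Z.subtype B)) ≃ₗ[𝕜]
        ⨁ (p : Fin (m + 1)),
          (↥(F ((p : ℕ) : ℤ) ⊓ Z) ⧸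
            (Submodule.comap (F ((p : ℕ) : ℤ) ⊓ Z).subtype
              (F (((p : ℕ) : ℤ) - 1) ⊓ Z ⊔ F ((p : ℕ) : ℤ) ⊓ B)))) := by
  have hmono : ∀ (d : ℕ) (a : ℤ), -1 ≤ a → a + d ≤ m → F a ≤ F (a + d) := by
    intro d
    induction d with
    | zero => intro a _ _; simp
    | succ d ih =>
      intro a h1 h2
      push_cast at h2 ⊢
      refine (ih a h1 (by omega)).trans ?_
      rw [← add_assoc]
      exact hFmono _ (by omega) (by omega)
  have hmono' : ∀ a b : ℤ, -1 ≤ a → a ≤ b → b ≤ m → F a ≤ F b := by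
    intro a b h1 h2 h3
    obtain ⟨d, rfl⟩ := Int.le.dest h2
    exact hmono d a h1 h3
  let N : ∀ p : Fin (m + 1), Submodule 𝕜 ↥(F ((p : ℕ) : ℤ) ⊓ Z) := fun p =>
    (Submodule.comap (F ((p : ℕ) : ℤ) ⊓ Z).subtype
              (F (((p : ℕ) : ℤ) - 1) ⊓ Z ⊔ F ((p : ℕ) : ℤ) ⊓ B))
  have hs : ∀ p : Fin (m + 1), ∃ s : (_ ⧸ N p) →ₗ[𝕜] ↥(F ((p : ℕ) : ℤ) ⊓ Z),
      (N p).mkQ ∘ₗ s = LinearMap.id := fun p =>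
    LinearMap.exists_rightInverse_of_surjective _ (N p).range_mkQ
  choose s hs using hs
  have hs' : ∀ p q, (N p).mkQ (s p q) = q := fun p q => LinearMap.congr_fun (hs p) q
  let ψ : (∀ p, (_ ⧸ N p)) →ₗ[𝕜] Z :=
    ∑ p, (Submodule.inclusion inf_le_right ∘ₗ s p) ∘ₗ LinearMap.proj p
  have hψ : ∀ q, ((ψ q : Z) : C) = ∑ p : Fin (m + 1), ((s p (q p) : ↥(F ((p : ℕ) : ℤ) ⊓ Z)) : C) := by
    intro q
    simp [ψ, LinearMap.sum_apply]
  let φ := (Submodule.comap Z.subtype B).mkQ ∘ₗ ψ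
  have hinj : Function.Injective φ := by
    rw [← LinearMap.ker_eq_bot, LinearMap.ker_eq_bot']
    intro q hq
    have hb : ((ψ q : Z) : C) ∈ B := by
      have : ψ q ∈ Submodule.comap Z.subtype B := (Submodule.Quotient.mk_eq_zero _).1 hq
      exact this
    rw [hψ] at hb
    have key : ∀ p : Fin (m + 1), (∀ j, p < j → q j = 0) → q p = 0 := by
      intro p hp
      have hlow : ∑ j ∈ Finset.univ.erase p, ((s j (q j) : ↥(F ((j : ℕ) : ℤ) ⊓ Z)) : C)
          ∈ F (((p : ℕ) : ℤ) - 1) ⊓ Z := by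
        refine Submodule.sum_mem _ fun j hj => ?_
        rcases lt_or_gt_of_ne (Finset.ne_of_mem_erase hj) with h | h
        · have h' : (j : ℕ) < p := h
          have := p.2
          exact ⟨hmono' _ _ (by omega) (by omega) (by omega) (s j (q j)).2.1, (s j (q j)).2.2⟩
        · rw [hp j h]; simp
      have hsum := Finset.add_sum_erase Finset.univ
        (fun j : Fin (m + 1) => ((s j (q j) : ↥(F ((j : ℕ) : ℤ) ⊓ Z)) : C)) (Finset.mem_univ p)
      rw [← hs' p (q p)]
      refine (Submodule.Quotient.mk_eq_zero _).2 ?_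
      change ((s p (q p) : ↥(F ((p : ℕ) : ℤ) ⊓ Z)) : C) ∈
        F (((p : ℕ) : ℤ) - 1) ⊓ Z ⊔ F ((p : ℕ) : ℤ) ⊓ B
      rw [← hsum] at hb
      have h2 := p.2
      have hF : F (((p : ℕ) : ℤ) - 1) ≤ F ((p : ℕ) : ℤ) :=
        hmono' _ _ (by omega) (by omega) (by omega)
      have hb2 := add_mem (s p (q p)).2.1 (hF hlow.1)
      have := Submodule.add_mem_sup (neg_mem hlow) (Submodule.mem_inf.2 ⟨hb2, hb⟩)
      convert this using 1
      abel
    have hall : ∀ p, q p = 0 := by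
      intro p
      induction p using WellFoundedGT.induction with
      | ind p ih => exact key p ih
    exact funext hall
  have hsurj : Function.Surjective φ := by
    have key : ∀ k : ℕ, k ≤ m + 1 → ∀ z : Z, (z : C) ∈ F ((k : ℤ) - 1) →
        (Submodule.comap Z.subtype B).mkQ z ∈ LinearMap.range φ := by
      intro k
      induction k with
      | zero =>
        intro _ z hz
        have : z = 0 := by simpa [hFbot] using hz
        rw [this, map_zero]; exact zero_mem _
      | succ k ih =>
        intro hk z hz
        have hz' : (z : C) ∈ F (k : ℤ) := by simpa using hz
        let p : Fin (m + 1) := ⟨k, by omega⟩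
        let zp : ↥(F ((p : ℕ) : ℤ) ⊓ Z) := ⟨z, hz', z.2⟩
        have h0 : zp - s p ((N p).mkQ zp) ∈ N p := by
          rw [← Submodule.Quotient.mk_eq_zero, ← Submodule.mkQ_apply, map_sub, hs', sub_self]
        have h1 : (z : C) - (s p ((N p).mkQ zp) : ↥(F ((p : ℕ) : ℤ) ⊓ Z)) ∈
          F ((k : ℤ) - 1) ⊓ Z ⊔ F (k : ℤ) ⊓ B := h0
        obtain ⟨u, hu, b, hb, hub⟩ := Submodule.mem_sup.1 h1
        have hr1 := ih (by omega) ⟨u, hu.2⟩ hu.1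
        have hr2 : φ (Pi.single p ((N p).mkQ zp)) ∈ LinearMap.range φ := ⟨_, rfl⟩
        have hval : ((ψ (Pi.single p ((N p).mkQ zp)) : Z) : C) =
            (s p ((N p).mkQ zp) : ↥(F ((p : ℕ) : ℤ) ⊓ Z)) := by
          rw [hψ, Finset.sum_eq_single p]
          · rw [Pi.single_eq_same]
          · intro j _ hj
            rw [Pi.single_eq_of_ne hj, map_zero]; rfl
          · simp
        have hr := add_mem hr1 hr2
        convert hr using 1
        change _ = (Submodule.comap Z.subtype B).mkQ _ + (Submodule.comap Z.subtype B).mkQ _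
        rw [← map_add]
        refine (Submodule.Quotient.eq _).2 ?_
        change (z : C) - (u + ((ψ (Pi.single p ((N p).mkQ zp)) : Z) : C)) ∈ B
        rw [hval]
        have : (z : C) - (u + (s p ((N p).mkQ zp) : ↥(F ((p : ℕ) : ℤ) ⊓ Z))) = b := by
          rw [add_comm, ← sub_sub, ← hub]; abel
        rw [this]; exact hb.2
    intro x
    obtain ⟨z, rfl⟩ := Submodule.mkQ_surjective _ x
    exact key (m + 1) le_rfl z (by simp [hFtop])
  exact ⟨(LinearEquiv.ofBijective φ ⟨hinj, hsurj⟩).symm.trans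
    (DirectSum.linearEquivFunOnFintype 𝕜 (Fin (m + 1)) (fun p => (_ ⧸ N p))).symm⟩
end

section
/- (Theorem 2.6.) Suppose there is an integer m ≥ 0 such that X_{p,q} = 0 for all p < 0, and X_{p,q} = C_{p+q} whenever p ≥ m or q ≤ 0. Then for every integer n ≥ 0 there is a 𝕜-linear isomorphism ker ∂_n / im ∂_{n+1} ≅ ⨁_{p=0}^{n} E^{m+1}_{p,n−p}, where E^{m+1}_{p,q} := Z^{m+1}_{p,q} / (Z^m_{p−1,q+1} + B^m_{p,q}). In the simplicial setting this says that the k-th homology of 𝒳 is isomorphic to the direct sum ⨁_{p=0}^{k} E^{m+1}_{p,k−p} of the entries of the (m+1)-st page of the Leray spectral sequence of f, where m = dim 𝒴. -/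
open Submodule

/-- `Z^r_{p,q} := X_{p,q} ⊓ ∂⁻¹(X_{p-r,q+r-1})`, a subspace of `C_{p+q}`. -/
def lerayZ {𝕜 V : Type*} [Field 𝕜] [AddCommGroup V] [Module 𝕜 V]
    (d : V →ₗ[𝕜] V) (X : ℤ → ℤ → Submodule 𝕜 V) (r p q : ℤ) : Submodule 𝕜 V :=
  X p q ⊓ (X (p - r) (q + r - 1)).comap d

/-- `B^r_{p,q} := X_{p,q} ⊓ ∂(X_{p+r,q-r+1})`, a subspace of `C_{p+q}`. -/
def lerayB {𝕜 V : Type*} [Field 𝕜] [AddCommGroup V] [Module 𝕜 V]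
    (d : V →ₗ[𝕜] V) (X : ℤ → ℤ → Submodule 𝕜 V) (r p q : ℤ) : Submodule 𝕜 V :=
  X p q ⊓ (X (p + r) (q - r + 1)).map d

/-- The spectral sequence page `E^r_{p,q} := Z^r_{p,q} / (Z^{r-1}_{p-1,q+1} + B^{r-1}_{p,q})`. -/
abbrev lerayE {𝕜 V : Type*} [Field 𝕜] [AddCommGroup V] [Module 𝕜 V]
    (d : V →ₗ[𝕜] V) (X : ℤ → ℤ → Submodule 𝕜 V) (r p q : ℤ) :=
  lerayZ d X r p q ⧸
    (Submodule.comap (lerayZ d X r p q).subtype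
      (lerayZ d X (r - 1) (p - 1) (q + 1) ⊔ lerayB d X (r - 1) p q))

open scoped DirectSum


theorem cardinal_sum_fin.{u} (N : ℕ) (f : Fin N → Cardinal.{u}) :
    Cardinal.sum f = ∑ i, f i := by
  induction N with
  | zero => simp [Cardinal.sum]
  | succ k ih =>
    rw [Fin.sum_univ_succ, ← ih]
    let e : (f 0).out ⊕ (Σ i : Fin k, (f i.succ).out) → Σ i, (f i).out :=
      Sum.elim (fun a => ⟨0, a⟩) (fun s => ⟨s.1.succ, s.2⟩)
    have he : Function.Bijective e := by
      constructor
      · rintro (a | ⟨i, a⟩) (b | ⟨j, b⟩) hab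
        · simpa [e] using hab
        · have := congrArg Sigma.fst hab
          exact absurd this (Fin.succ_ne_zero j).symm
        · have := congrArg Sigma.fst hab
          exact absurd this (Fin.succ_ne_zero i)
        · have h1 : i = j := Fin.succ_injective _ (congrArg Sigma.fst hab)
          subst h1
          simpa [e] using hab
      · rintro ⟨i, a⟩
        induction i using Fin.cases with
        | zero => exact ⟨Sum.inl a, rfl⟩
        | succ i => exact ⟨Sum.inr ⟨i, a⟩, rfl⟩
    have h := Cardinal.mk_congr (Equiv.ofBijective e he)
    rw [Cardinal.mk_sum, Cardinal.mk_out, Cardinal.lift_id, Cardinal.lift_id] at h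
    exact h.symm

noncomputable def relRank {𝕜 V : Type*} [Field 𝕜] [AddCommGroup V] [Module 𝕜 V]
    (A B : Submodule 𝕜 V) : Cardinal :=
  Module.rank 𝕜 (A ⧸ Submodule.comap A.subtype B)

theorem relRank_zero {𝕜 V : Type*} [Field 𝕜] [AddCommGroup V] [Module 𝕜 V]
    (A B : Submodule 𝕜 V) (h : A ≤ B) : relRank A B = 0 := by
  unfold relRank
  have : Subsingleton (A ⧸ Submodule.comap A.subtype B) := by
    rw [Submodule.Quotient.subsingleton_iff, Submodule.comap_subtype_eq_top]
    exact h
  exact rank_subsingleton' _ _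

theorem relRank_step {𝕜 V : Type*} [Field 𝕜] [AddCommGroup V] [Module 𝕜 V]
    (A A' B : Submodule 𝕜 V) (h : A ≤ A') :
    relRank A' B = relRank A B + relRank A' (A ⊔ A' ⊓ B) := by
  unfold relRank
  let Q := A' ⧸ Submodule.comap A'.subtype B
  let g : A →ₗ[𝕜] Q := (Submodule.comap A'.subtype B).mkQ ∘ₗ Submodule.inclusion h
  have hg : LinearMap.ker g = Submodule.comap A.subtype B := by
    ext x
    rw [LinearMap.mem_ker]
    exact Submodule.Quotient.mk_eq_zero _
  let k : A' →ₗ[𝕜] (Q ⧸ LinearMap.range g) :=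
    (LinearMap.range g).mkQ ∘ₗ (Submodule.comap A'.subtype B).mkQ
  have hk : LinearMap.ker k = Submodule.comap A'.subtype (A ⊔ A' ⊓ B) := by
    ext x
    rw [LinearMap.mem_ker]
    refine (Submodule.Quotient.mk_eq_zero _).trans ?_
    rw [LinearMap.mem_range, Submodule.mem_comap, Submodule.mem_sup]
    have hiff : ∀ y : A, g y = (Submodule.comap A'.subtype B).mkQ x ↔
        ((Submodule.inclusion h y - x : A') : V) ∈ B :=
      fun y => Submodule.Quotient.eq _
    change (∃ y, g y = (Submodule.comap A'.subtype B).mkQ x) ↔ _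
    simp only [hiff]
    constructor
    · rintro ⟨y, hy⟩
      refine ⟨y, y.2, (x : V) - y, ⟨A'.sub_mem x.2 (h y.2), ?_⟩, by abel⟩
      have := B.neg_mem hy
      simpa using this
    · rintro ⟨y, hy, z, hz, hyz⟩
      refine ⟨⟨y, hy⟩, ?_⟩
      have h1 : ((Submodule.inclusion h ⟨y, hy⟩ - x : A') : V) = -z := by
        have h2 : y + z = (x : V) := hyz
        simp [← h2]
      rw [h1]
      exact B.neg_mem hz.2
  have hks : Function.Surjective k :=
    (Submodule.mkQ_surjective _).comp (Submodule.mkQ_surjective _)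
  rw [← hg, ← hk, (g.quotKerEquivRange).rank_eq,
    (k.quotKerEquivOfSurjective hks).rank_eq, add_comm]
  exact (Submodule.rank_quotient_add_rank (LinearMap.range g)).symm

theorem relRank_sum {𝕜 V : Type*} [Field 𝕜] [AddCommGroup V] [Module 𝕜 V]
    (F : ℕ → Submodule 𝕜 V) (hF : ∀ i, F i ≤ F (i + 1)) (h0 : F 0 = ⊥)
    (B : Submodule 𝕜 V) (N : ℕ) :
    relRank (F N) B = ∑ i ∈ Finset.range N, relRank (F (i + 1)) (F i ⊔ F (i + 1) ⊓ B) := by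
  induction N with
  | zero => simp [h0, relRank_zero]
  | succ k ih => rw [Finset.sum_range_succ, ← ih, ← relRank_step _ _ _ (hF k)]

theorem theorem_two_six
    {𝕜 V : Type*} [Field 𝕜] [AddCommGroup V] [Module 𝕜 V]
    (C : ℤ → Submodule 𝕜 V) (d : V →ₗ[𝕜] V)
    (hdC : ∀ n : ℤ, (C n).map d ≤ C (n - 1))
    (hdd : ∀ n : ℤ, ∀ x ∈ C n, d (d x) = 0)
    (X : ℤ → ℤ → Submodule 𝕜 V)
    (hXC : ∀ p q : ℤ, X p q ≤ C (p + q))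
    (hXmono : ∀ p q : ℤ, X p q ≤ X (p + 1) (q - 1))
    (hXd : ∀ p q : ℤ, (X p q).map d ≤ X p (q - 1))
    (m : ℤ) (hm : 0 ≤ m)
    (hXneg : ∀ p q : ℤ, p < 0 → X p q = ⊥)
    (hXtop : ∀ p q : ℤ, m ≤ p ∨ q ≤ 0 → X p q = C (p + q)) :
    ∀ n : ℤ, 0 ≤ n →
      Nonempty
        ((↥(C n ⊓ LinearMap.ker d) ⧸
            (Submodule.comap (C n ⊓ LinearMap.ker d).subtype ((C (n + 1)).map d))) ≃ₗ[𝕜]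
          ⨁ (p : Fin (n.toNat + 1)), lerayE d X (m + 1) ((p : ℕ) : ℤ) (n - ((p : ℕ) : ℤ))) := by
  intro n hn
  have hX : ∀ {a b a' b' : ℤ}, a = a' → b = b' → X a b = X a' b' := by
    rintro _ _ _ _ rfl rfl; rfl
  let F : ℕ → Submodule 𝕜 V := fun i => X ((i : ℤ) - 1) (n - i + 1) ⊓ LinearMap.ker d
  have hF : ∀ i, F i ≤ F (i + 1) := by
    intro i
    refine inf_le_inf_right _ ((hXmono _ _).trans (le_of_eq (hX ?_ ?_))) <;> push_cast <;> ring
  have h0 : F 0 = ⊥ := by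
    simp only [F]
    rw [hXneg _ _ (by simp)]; simp
  have hN : F (n.toNat + 1) = C n ⊓ LinearMap.ker d := by
    simp only [F]
    rw [hXtop _ _ (Or.inr (by push_cast; omega))]
    congr 2
    push_cast; omega
  have key : ∀ p : ℕ, relRank (lerayZ d X (m + 1) p (n - p))
      (lerayZ d X (m + 1 - 1) (p - 1) (n - p + 1) ⊔ lerayB d X (m + 1 - 1) p (n - p))
      = relRank (F (p + 1)) (F p ⊔ F (p + 1) ⊓ (C (n + 1)).map d) := by
    intro p
    by_cases hp : (p : ℤ) ≤ m
    · have e0 : X ((p + 1 : ℕ) - 1) (n - (p + 1 : ℕ) + 1) = X p (n - p) :=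
        hX (by push_cast; ring) (by push_cast; ring)
      have e1 : lerayZ d X (m + 1) p (n - p) = F (p + 1) := by
        simp only [lerayZ, F]
        rw [hXneg (p - (m + 1)) _ (by omega), e0]
        rfl
      have e2 : lerayZ d X (m + 1 - 1) (p - 1) (n - p + 1) = F p := by
        simp only [lerayZ, F]
        rw [hXneg (p - 1 - (m + 1 - 1)) _ (by omega)]
        rfl
      have e3 : lerayB d X (m + 1 - 1) p (n - p) = F (p + 1) ⊓ (C (n + 1)).map d := by
        simp only [lerayB, F]
        rw [hXtop (p + (m + 1 - 1)) _ (Or.inl (by omega)), e0]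
        have : (p + (m + 1 - 1) + (n - p - (m + 1 - 1) + 1) : ℤ) = n + 1 := by ring
        rw [this, inf_assoc]
        congr 1
        refine (inf_eq_right.2 ?_).symm
        rintro _ ⟨x, hx, rfl⟩
        exact hdd _ x hx
      rw [e1, e2, e3]
    · rw [relRank_zero, relRank_zero]
      · refine le_trans ?_ le_sup_left
        simp only [F]
        refine inf_le_inf_right _ ?_
        rw [hXtop _ _ (Or.inl (by push_cast; omega)), hXtop _ _ (Or.inl (by omega))]
        apply le_of_eq
        congr 1
        push_cast; ring
      · refine le_trans ?_ le_sup_left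
        simp only [lerayZ]
        rw [hXtop p _ (Or.inl (by omega)), hXtop (p - 1) _ (Or.inl (by omega))]
        apply le_of_eq
        rw [hX (show (p - (m + 1) : ℤ) = p - 1 - (m + 1 - 1) by ring)
          (show (n - p + (m + 1) - 1 : ℤ) = n - p + 1 + (m + 1 - 1) - 1 by ring)]
        congr 2
        ring
  rw [Module.nonempty_linearEquiv_iff_rank_eq, rank_directSum, cardinal_sum_fin]
  change relRank (C n ⊓ LinearMap.ker d) ((C (n + 1)).map d) = ∑ p : Fin (n.toNat + 1),
    relRank (lerayZ d X (m + 1) ((p : ℕ) : ℤ) (n - ((p : ℕ) : ℤ)))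
      (lerayZ d X (m + 1 - 1) (((p : ℕ) : ℤ) - 1) (n - ((p : ℕ) : ℤ) + 1) ⊔
        lerayB d X (m + 1 - 1) ((p : ℕ) : ℤ) (n - ((p : ℕ) : ℤ)))
  rw [← hN, relRank_sum F hF h0, ← Fin.sum_univ_eq_sum_range
    (fun i => relRank (F (i + 1)) (F i ⊔ F (i + 1) ⊓ (C (n + 1)).map d))]
  exact Finset.sum_congr rfl fun p _ => (key p).symm
end
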